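/- Let η ∈ (0,1/4), let ε₁,…,ε₄ ∈ {±1} and G(x) = ε₁x₁²+ε₂x₂²+ε₃x₃²+ε₄x₄². Let v ∈ ℝ⁴\{0} and θ ∈ ℝ satisfy max_i|v_i| ≥ 5|θ|, and set f(x) = θ·G(x) − (v₁x₁+v₂x₂+v₃x₃+v₄x₄). Let N ∈ ℕ and C ≥ 1, and suppose w̃ : ℝ⁴ → ℝ is smooth, supported in [−2,2]⁴, satisfies w̃(x) = 0 whenever max_i|x_i| ≤ η, and |∂^α w̃(x)| ≤ C·η^{−|α|} for all x and all multi-indices α with |α| ≤ N. Then |∫_{ℝ⁴} w̃(x)·e(f(x)) dx| ≤ c(N,C)·(η·max_i|v_i|)^{−N}, where the constant c(N,C) depends only on N and C, and e(t) = e^{2πit}. -/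

import Mathlib

open scoped BigOperators
open MeasureTheory Filter

attribute [local instance 0] Classical.propDecidable

noncomputable section

/-- `e(t) = exp(2πit)`. -/
def eC (t : ℝ) : ℂ := Complex.exp (2 * Real.pi * Complex.I * t)

/-- A nonzero integer `z` is squareful if `p² ∣ z` for every prime `p` dividing `z`. -/
def Squareful (z : ℤ) : Prop := ∀ p : ℕ, p.Prime → (p : ℤ) ∣ z → (p : ℤ) ^ 2 ∣ z

/-- The standard bump function in one variable. -/
def psi1 (t : ℝ) : ℝ := if |t| < 1 then Real.exp (-(1 - t ^ 2)⁻¹) else 0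

/-- The smooth weight `w₁`. -/
def w1 (η : ℝ) (x : Fin 4 → ℝ) : ℝ :=
  if ‖x‖ ≤ η then 0
  else if ‖x‖ ≤ 2 * η then Real.exp 1 * psi1 (‖x‖ / η - 2)
  else if ‖x‖ ≤ 1 - η then 1
  else if ‖x‖ ≤ 1 then Real.exp 1 * psi1 (‖x‖ / η - (1 - η) / η)
  else 0

/-- The smooth weight `w₂`. -/
def w2 (η : ℝ) (x : Fin 4 → ℝ) : ℝ :=
  if ‖x‖ ≤ η then 0
  else if ‖x‖ ≤ 2 * η then Real.exp 1 * psi1 (‖x‖ / η - 2)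
  else if ‖x‖ ≤ 1 then 1
  else if ‖x‖ ≤ 1 + η then Real.exp 1 * psi1 (‖x‖ / η - 1 / η)
  else 0

/-- `u(t) = c₀ ψ₁(4t - 3)`, normalised so that `∫ u = 1`. -/
def uFn (t : ℝ) : ℝ := (∫ s : ℝ, psi1 (4 * s - 3))⁻¹ * psi1 (4 * t - 3)

/-- Heath-Brown's function `h(x, y)`. -/
def hFn (x y : ℝ) : ℝ :=
  ∑' j : ℕ, (x * ((j : ℝ) + 1))⁻¹ *
    (uFn (x * ((j : ℝ) + 1)) - uFn (|y| / (x * ((j : ℝ) + 1))))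

/-- The exponential sum `S_{q,a}(c)`. -/
def Sqa (a c : Fin 4 → ℤ) (q : ℕ) : ℂ :=
  ∑ k ∈ (Finset.range q).filter fun k => Nat.gcd k q = 1,
    ∑ b ∈ Fintype.piFinset fun _ : Fin 4 => Finset.range q,
      eC (((((k : ℤ) * (∑ i, a i * (b i : ℤ) ^ 2) + ∑ i, (b i : ℤ) * c i) : ℤ) : ℝ) / (q : ℝ))

/-- Partial sums of the singular series `𝔊_a`. -/
def singularPartial (a : Fin 4 → ℤ) (T : ℕ) : ℂ :=
  ∑ q ∈ Finset.Icc 1 T, (1 / (q : ℂ) ^ 4) * Sqa a 0 q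

/-- The quadratic form `G(x) = Σ εᵢ xᵢ²`. -/
def Gquad (e : Fin 4 → ℤ) (x : Fin 4 → ℝ) : ℝ := ∑ i, (e i : ℝ) * x i ^ 2

/-- The singular integral `σ_∞(ε)`. -/
def sigmaInf (e : Fin 4 → ℤ) : ℂ :=
  ∫ θ : ℝ, ∫ x in Set.univ.pi fun _ : Fin 4 => Set.Icc (-1 : ℝ) 1, eC (-(θ * Gquad e x))

/-- The weighted singular integral `σ_∞(w)`. -/
def sigmaInfW (w : (Fin 4 → ℝ) → ℝ) (e : Fin 4 → ℤ) : ℂ :=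
  ∫ θ : ℝ, ∫ x : Fin 4 → ℝ, (w x : ℂ) * eC (-(θ * Gquad e x))

/-- `Pᵢ = (B / |aᵢ|)^{1/2}`. -/
def Pvec (a : Fin 4 → ℤ) (B : ℝ) (i : Fin 4) : ℝ := Real.sqrt (B / ((a i).natAbs : ℝ))

/-- The oscillatory integral `I_{q,a}(c)`. -/
def Iqa (w : (Fin 4 → ℝ) → ℝ) (a : Fin 4 → ℤ) (B : ℝ) (c : Fin 4 → ℤ) (q : ℝ) : ℂ :=
  ∫ x : Fin 4 → ℝ,
    (w (fun i => x i / Pvec a B i) : ℂ) *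
      (hFn (q / Real.sqrt B) ((∑ i, (a i : ℝ) * x i ^ 2) / B) : ℂ) *
      eC (-(∑ i, (c i : ℝ) * x i) / q)

/-- `Δ(v) = ∏ᵢ gcd(vᵢ, ∏_{j≠i} vⱼ)`. -/
def Delta4 (v : Fin 4 → ℤ) : ℕ :=
  ∏ i, Int.gcd (v i) (∏ j ∈ Finset.univ.erase i, v j)

/-- `Δ_c(a) = ∏ᵢ gcd(gcd(aᵢ,cᵢ), ∏_{j≠i} gcd(aⱼ,cⱼ))`. -/
def DeltaC (a c : Fin 4 → ℤ) : ℕ :=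
  ∏ i, Int.gcd (Int.gcd (a i) (c i) : ℤ) (∏ j ∈ Finset.univ.erase i, (Int.gcd (a j) (c j) : ℤ))

/-- The dual form `F*_a(c)`. -/
def dualForm (a c : Fin 4 → ℤ) : ℤ :=
  ∑ i, (∏ j ∈ Finset.univ.erase i, a j) * c i ^ 2

/-- The counting function `N_a(B)`. -/
def Na (a : Fin 4 → ℤ) (B : ℝ) : ℕ :=
  {x : Fin 4 → ℤ | (∀ i, x i ≠ 0) ∧ (∑ i, a i * x i ^ 2) = 0 ∧
    ∀ i, (((a i * x i ^ 2).natAbs : ℝ)) ≤ B}.ncard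

/-- The smoothly weighted counting function `N_{w,a}(B)`. -/
def Nwa (w : (Fin 4 → ℝ) → ℝ) (a : Fin 4 → ℤ) (B : ℝ) : ℝ :=
  ∑' x : Fin 4 → ℤ,
    if (∀ i, x i ≠ 0) ∧ (∑ i, a i * x i ^ 2) = 0 then
      w fun i => (x i : ℝ) / Pvec a B i
    else 0

/-- The inclusion-exclusion weights `ω(r, s, s₀)`. -/
def omegaFn (r s : Fin 4 → ℕ) (s0 : ℕ) : ℤ :=
  if (∀ i, Squarefree (r i)) ∧ (∀ i, Squarefree (s i)) ∧
      Finset.univ.gcd s = 1 ∧ (∀ i, Nat.gcd s0 (s i) = 1) ∧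
      ∀ p : ℕ, p.Prime → p ∣ (∏ i, r i) * ∏ i, s i → ∀ i, p ∣ r i * s i then
    ArithmeticFunction.moebius s0 *
      ∏ p ∈ ((∏ i, r i) * ∏ i, s i).primeFactors,
        (-1 : ℤ) ^ (((∏ i, r i) * ∏ i, s i).factorization p + 1)
  else 0

/-- The cardinality of the set `𝒩(B; r, s, s₀)`. -/
def calN (B D : ℝ) (r s : Fin 4 → ℕ) (s0 : ℕ) : ℕ :=
  {z : Fin 4 → ℤ | (∀ i, z i ≠ 0) ∧ (∀ i, Squareful (z i)) ∧
    (∀ i, (((z i).natAbs : ℝ)) ≤ B) ∧ (∑ i, z i) = 0 ∧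
    ∃ x y : Fin 4 → ℤ,
      (∀ i, 0 < x i ∧ Squarefree (y i) ∧ z i = x i ^ 2 * y i ^ 3 ∧
        (r i : ℤ) ∣ y i ∧ (s i : ℤ) ∣ x i ∧ (s0 : ℤ) ∣ x i) ∧
      (((∏ i, y i).natAbs : ℝ)) ≤ D ∧ ¬ IsSquare (∏ i, y i)}.ncard

/-- The local counting function `M_n(y, p)`. -/
def Mcount (y : Fin 4 → ℤ) (p n : ℕ) : ℕ :=
  {m : Fin 4 → ℕ | (∀ i, m i < p ^ n) ∧ ((p : ℤ) ^ n ∣ ∑ i, y i ^ 3 * (m i : ℤ) ^ 2) ∧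
    ∃ j, ¬ (p : ℤ) ∣ (m j : ℤ) * y j}.ncard

end

noncomputable section

lemma hasDerivAt_eC_phase (a v b t : ℝ) :
    HasDerivAt (fun t : ℝ => eC (a * t ^ 2 - v * t + b))
      (2 * Real.pi * Complex.I * ((2 * a * t - v : ℝ) : ℂ) * eC (a * t ^ 2 - v * t + b)) t := by
  unfold eC
  have h1 : HasDerivAt (fun t : ℝ => a * t ^ 2 - v * t + b) (2 * a * t - v) t := by
    have := (((hasDerivAt_id t).pow 2).const_mul a).sub ((hasDerivAt_id t).const_mul v)
    have := this.add_const b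
    refine this.congr_deriv ?_
    simp only [id]; ring_nf
  have h2 := ((h1.ofReal_comp).const_mul (2 * Real.pi * Complex.I)).cexp
  convert h2 using 1
  ring

lemma norm_eC (t : ℝ) : ‖eC t‖ = 1 := by
  unfold eC
  rw [show 2 * Real.pi * Complex.I * (t : ℂ) = ((2 * Real.pi * t : ℝ) : ℂ) * Complex.I by
    push_cast; ring]
  exact Complex.norm_exp_ofReal_mul_I _

lemma continuous_eC : Continuous eC := by unfold eC; fun_prop

/-- the one-dimensional integral with negative powers of the derivative of the phase. -/
def Iint (a v b : ℝ) (p : ℕ) (g : ℝ → ℝ) : ℂ :=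
  ∫ t in (-(9/4) : ℝ)..(9/4), ((g t * ((2 * a * t - v) ^ p)⁻¹ : ℝ) : ℂ) *
    eC (a * t ^ 2 - v * t + b)

lemma phase_lower {a v t : ℝ} (h : 5 * |a| ≤ |v|) (ht : t ∈ Set.uIcc (-(9/4) : ℝ) (9/4)) :
    |v| / 10 ≤ |2 * a * t - v| := by
  rw [Set.uIcc_of_le (by norm_num)] at ht
  have h1 : |t| ≤ 9 / 4 := abs_le.2 ht
  have h2 : |v| - |2 * a * t| ≤ |2 * a * t - v| := by
    rw [abs_sub_comm]; exact abs_sub_abs_le_abs_sub _ _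
  have h3 : |2 * a * t| = 2 * |a| * |t| := by rw [abs_mul, abs_mul]; norm_num
  nlinarith [abs_nonneg a, abs_nonneg t]

lemma Iint_step (a v b : ℝ) (p : ℕ) (g : ℝ → ℝ) (h : 5 * |a| ≤ |v|) (hv : v ≠ 0)
    (hg : ContDiff ℝ (⊤ : ℕ∞) g) (hs : ∀ t, 2 < |t| → g t = 0) :
    2 * Real.pi * Complex.I * Iint a v b p g =
      - (Iint a v b (p + 1) (deriv g) - ((p + 1) * (2 * a) : ℝ) * Iint a v b (p + 2) g) := by
  have hne : ∀ t ∈ Set.uIcc (-(9/4) : ℝ) (9/4), 2 * a * t - v ≠ 0 := by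
    intro t ht h0
    have := phase_lower h ht
    rw [h0, abs_zero] at this
    have := abs_pos.2 hv
    linarith
  have hc : ∀ (q : ℕ) (f : ℝ → ℝ), Continuous f → IntervalIntegrable
      (fun t : ℝ => ((f t * ((2 * a * t - v) ^ q)⁻¹ : ℝ) : ℂ) * eC (a * t ^ 2 - v * t + b))
      volume (-(9/4) : ℝ) (9/4) := by
    intro q f hf
    apply ContinuousOn.intervalIntegrable
    apply ContinuousOn.mul
    · apply Complex.continuous_ofReal.comp_continuousOn
      apply hf.continuousOn.mul
      apply ContinuousOn.inv₀ (by fun_prop)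
      intro t ht
      exact pow_ne_zero _ (hne t ht)
    · exact (continuous_eC.comp (by fun_prop)).continuousOn
  have hgc : Continuous g := hg.continuous
  have hdc : Continuous (deriv g) := hg.continuous_deriv (by simp)
  have hd : ∀ t ∈ Set.uIcc (-(9/4) : ℝ) (9/4), HasDerivAt
      (fun t : ℝ => ((g t * ((2 * a * t - v) ^ (p+1))⁻¹ : ℝ) : ℂ) * eC (a * t ^ 2 - v * t + b))
      (((deriv g t * ((2 * a * t - v) ^ (p+1))⁻¹ : ℝ) : ℂ) * eC (a * t ^ 2 - v * t + b)
        - ((p + 1) * (2 * a) : ℝ) *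
          (((g t * ((2 * a * t - v) ^ (p+2))⁻¹ : ℝ) : ℂ) * eC (a * t ^ 2 - v * t + b))
        + 2 * Real.pi * Complex.I *
          (((g t * ((2 * a * t - v) ^ p)⁻¹ : ℝ) : ℂ) * eC (a * t ^ 2 - v * t + b))) t := by
    intro t ht
    have h0 := hne t ht
    have h1 : HasDerivAt g (deriv g t) t :=
      ((hg.differentiable (by simp)) t).hasDerivAt
    have h2 : HasDerivAt (fun t : ℝ => 2 * a * t - v) (2 * a) t := by
      simpa using ((hasDerivAt_id t).const_mul (2 * a)).sub_const v
    have h3 := (h2.pow (p+1)).inv (pow_ne_zero _ h0)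
    have h4 := ((h1.mul h3).ofReal_comp).mul (hasDerivAt_eC_phase a v b t)
    refine h4.congr_deriv ?_
    have h0' : ((2 * a * t - v : ℝ) : ℂ) ≠ 0 := by exact_mod_cast h0
    try simp only [Pi.pow_apply, Pi.inv_apply, Pi.mul_apply]
    generalize eC (a * t ^ 2 - v * t + b) = E
    generalize 2 * a * t - v = D at *
    push_cast
    try simp only [Nat.add_sub_cancel]
    field_simp
    ring
  have key := intervalIntegral.integral_eq_sub_of_hasDerivAt hd
    ((((hc _ _ hdc)).sub ((hc _ _ hgc).const_mul _)).add ((hc _ _ hgc).const_mul _))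
  rw [intervalIntegral.integral_add (((hc _ _ hdc)).sub ((hc _ _ hgc).const_mul _))
      ((hc _ _ hgc).const_mul _),
    intervalIntegral.integral_sub (hc _ _ hdc) ((hc _ _ hgc).const_mul _),
    intervalIntegral.integral_const_mul, intervalIntegral.integral_const_mul,
    hs (9/4) (by norm_num [abs_of_pos]), hs (-(9/4)) (by norm_num [abs_of_pos])] at key
  unfold Iint
  simp only [zero_mul, Complex.ofReal_zero, sub_self] at key
  linear_combination key

lemma Iint_bound (N : ℕ) : ∀ p : ℕ, ∃ c : ℝ, 0 < c ∧ ∀ (a v b η C : ℝ) (g : ℝ → ℝ),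
    0 < η → η ≤ 1 → v ≠ 0 → 5 * |a| ≤ |v| → 0 ≤ C →
    ContDiff ℝ (⊤ : ℕ∞) g → (∀ t, 2 < |t| → g t = 0) →
    (∀ n ≤ N, ∀ t, |iteratedDeriv n g t| ≤ C * (η⁻¹) ^ n) →
    ‖Iint a v b p g‖ ≤ c * C * (|v|⁻¹) ^ p * ((η * |v|)⁻¹) ^ N := by
  induction N with
  | zero =>
    intro p
    refine ⟨(9/2) * 10 ^ p, by positivity, ?_⟩
    intro a v b η C g hη hη1 hv h hC hg hs hb
    have hv' := abs_pos.2 hv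
    have : ‖Iint a v b p g‖ ≤ (C * (10 ^ p * (|v|⁻¹) ^ p)) * |(9/4 : ℝ) - (-(9/4))| := by
      apply intervalIntegral.norm_integral_le_of_norm_le_const
      intro t ht
      have h1 := phase_lower h (Set.uIoc_subset_uIcc ht)
      rw [norm_mul, norm_eC, mul_one, Complex.norm_real, Real.norm_eq_abs, abs_mul]
      have h2 := hb 0 le_rfl t
      simp only [iteratedDeriv_zero, pow_zero, mul_one] at h2
      have h3 : |((2 * a * t - v) ^ p)⁻¹| ≤ 10 ^ p * (|v|⁻¹) ^ p := by
        rw [abs_inv, abs_pow, ← inv_pow, ← mul_pow]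
        apply pow_le_pow_left₀ (by positivity)
        calc |2 * a * t - v|⁻¹ ≤ (|v| / 10)⁻¹ := by
              apply inv_anti₀ (by positivity) h1
          _ = _ := by field_simp
      exact mul_le_mul h2 h3 (abs_nonneg _) hC
    have h9 : |(9/4 : ℝ) - (-(9/4))| = 9/2 := by norm_num [abs_of_pos]
    rw [h9] at this
    refine this.trans (le_of_eq ?_)
    ring
  | succ N ih =>
    intro p
    obtain ⟨c1, hc1, H1⟩ := ih (p + 1)
    obtain ⟨c2, hc2, H2⟩ := ih (p + 2)
    refine ⟨c1 + (p + 1) * c2, by positivity, ?_⟩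
    intro a v b η C g hη hη1 hv h hC hg hs hb
    have hv' := abs_pos.2 hv
    have hstep := Iint_step a v b p g h hv hg hs
    have hB1 := H1 a v b η (C * η⁻¹) (deriv g) hη hη1 hv h (by positivity)
      (by
        have : ContDiff ℝ ((⊤ : ℕ∞) + 1) g := by simpa using hg
        exact (contDiff_succ_iff_deriv.1 this).2.2)
      (by
        intro t ht
        have : g =ᶠ[nhds t] fun _ => 0 := by
          filter_upwards [(isOpen_lt continuous_const continuous_abs).mem_nhds ht] with s hs'
          exact hs s hs'
        rw [this.deriv_eq]; simp)
      (by
        intro n hn t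
        rw [← iteratedDeriv_succ']
        refine (hb (n+1) (by omega) t).trans (le_of_eq ?_)
        rw [pow_succ]; ring)
    have hB2 := H2 a v b η C g hη hη1 hv h hC hg hs (fun n hn => hb n (by omega))
    have hn := congrArg norm hstep
    rw [norm_neg, norm_mul, norm_mul, norm_mul, Complex.norm_I, Complex.norm_real] at hn
    have hpi : ‖Real.pi‖ = Real.pi := abs_of_pos Real.pi_pos
    rw [hpi, Complex.norm_ofNat] at hn
    have h4 := norm_sub_le (Iint a v b (p + 1) (deriv g))
      (((p + 1) * (2 * a) : ℝ) * Iint a v b (p + 2) g)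
    rw [norm_mul, Complex.norm_real, Real.norm_eq_abs, abs_mul, abs_mul,
      abs_of_pos (by positivity : (0:ℝ) < p + 1), abs_two] at h4
    have h5 : ‖Iint a v b p g‖ ≤ 2 * Real.pi * 1 * ‖Iint a v b p g‖ := by
      have := Real.pi_gt_three
      nlinarith [norm_nonneg (Iint a v b p g)]
    have h6 : (p + 1 : ℝ) * (2 * |a|) * ‖Iint a v b (p + 2) g‖ ≤
        (p + 1 : ℝ) * |v| * (c2 * C * (|v|⁻¹) ^ (p+2) * ((η * |v|)⁻¹) ^ N) := by
      apply mul_le_mul _ hB2 (norm_nonneg _) (by positivity)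
      apply mul_le_mul_of_nonneg_left _ (by positivity)
      linarith [abs_nonneg a]
    have h7 : (p + 1 : ℝ) * |v| * (c2 * C * (|v|⁻¹) ^ (p+2) * ((η * |v|)⁻¹) ^ N) ≤
        (p + 1) * c2 * C * (|v|⁻¹) ^ p * ((η * |v|)⁻¹) ^ (N+1) := by
      have : (p + 1 : ℝ) * |v| * (c2 * C * (|v|⁻¹) ^ (p+2) * ((η * |v|)⁻¹) ^ N) =
        (p + 1) * c2 * C * (|v|⁻¹) ^ p * ((η * |v|)⁻¹) ^ N * |v|⁻¹ := by
        have h0 : |v| * |v|⁻¹ = 1 := mul_inv_cancel₀ hv'.ne'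
        rw [pow_add]
        linear_combination ((p + 1) * c2 * C * (|v|⁻¹) ^ p * ((η * |v|)⁻¹) ^ N * |v|⁻¹) * h0
      rw [this, pow_succ, ← mul_assoc]
      apply mul_le_mul_of_nonneg_left _ (by positivity)
      apply inv_anti₀ (by positivity)
      nlinarith
    have h8 : c1 * (C * η⁻¹) * (|v|⁻¹) ^ (p+1) * ((η * |v|)⁻¹) ^ N =
        c1 * C * (|v|⁻¹) ^ p * ((η * |v|)⁻¹) ^ (N+1) := by
      rw [pow_succ, pow_succ, mul_inv]; ring
    calc ‖Iint a v b p g‖ ≤ _ := h5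
      _ = _ := hn
      _ ≤ _ := h4
      _ ≤ c1 * (C * η⁻¹) * (|v|⁻¹) ^ (p+1) * ((η * |v|)⁻¹) ^ N +
          (p + 1) * c2 * C * (|v|⁻¹) ^ p * ((η * |v|)⁻¹) ^ (N+1) :=
            add_le_add hB1 (h6.trans h7)
      _ = _ := by rw [h8]; ring

lemma insertNth_eq_affine (i : Fin 4) (y : Fin 3 → ℝ) (t : ℝ) :
    (i.insertNth t y : Fin 4 → ℝ) =
      ContinuousLinearMap.single ℝ (fun _ : Fin 4 => ℝ) i t + i.insertNth 0 y := by
  ext j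
  refine Fin.succAboveCases i ?_ (fun k => ?_) j
  · simp
  · simp [Fin.succAbove_ne]

lemma slice_deriv (w : (Fin 4 → ℝ) → ℝ) (hw : ContDiff ℝ (⊤ : ℕ∞) w) (i : Fin 4)
    (y : Fin 3 → ℝ) (n : ℕ) (t K : ℝ) (hK : ∀ x, ‖iteratedFDeriv ℝ n w x‖ ≤ K) :
    |iteratedDeriv n (fun s : ℝ => w (i.insertNth s y)) t| ≤ K := by
  have h1 : (fun s : ℝ => w (i.insertNth s y)) = (fun x => w (x + i.insertNth 0 y)) ∘
      (ContinuousLinearMap.single ℝ (fun _ : Fin 4 => ℝ) i) := by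
    ext s
    simp only [Function.comp]
    rw [insertNth_eq_affine]
  have h2 : ContDiff ℝ (⊤ : ℕ∞) (fun x => w (x + i.insertNth 0 y)) :=
    hw.comp (contDiff_id.add contDiff_const)
  rw [← Real.norm_eq_abs, ← norm_iteratedFDeriv_eq_norm_iteratedDeriv, h1,
    ContinuousLinearMap.iteratedFDeriv_comp_right _ (n := (⊤ : ℕ∞))
      h2 _ (by exact_mod_cast le_top),
    iteratedFDeriv_comp_add_right]
  refine (ContinuousMultilinearMap.norm_compContinuousLinearMap_le _ _).trans ?_
  have hs : ‖ContinuousLinearMap.single ℝ (fun _ : Fin 4 => ℝ) i‖ ≤ 1 := by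
    apply ContinuousLinearMap.opNorm_le_bound _ zero_le_one
    intro s
    rw [one_mul]
    refine (pi_norm_le_iff_of_nonneg (norm_nonneg _)).2 (fun j => ?_)
    by_cases hj : j = i
    · subst hj; simp
    · simp [hj]
  refine (mul_le_of_le_one_right (norm_nonneg _) ?_).trans (hK _)
  exact Finset.prod_le_one (fun _ _ => norm_nonneg _) (fun _ _ => hs)

end

/-- Lemma 4.12: the first derivative test. -/
theorem statement_11 (N : ℕ) (C : ℝ) (hC : 1 ≤ C) :
    ∃ c : ℝ, 0 < c ∧
      ∀ (η : ℝ) (e : Fin 4 → ℤ) (v : Fin 4 → ℝ) (θ : ℝ) (w : (Fin 4 → ℝ) → ℝ),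
        η ∈ Set.Ioo (0 : ℝ) (1 / 4) → (∀ i, e i = 1 ∨ e i = -1) →
        v ≠ 0 → 5 * |θ| ≤ ‖v‖ →
        ContDiff ℝ (⊤ : ℕ∞) w →
        (∀ x : Fin 4 → ℝ, x ∉ Set.Icc (fun _ => (-2 : ℝ)) (fun _ => 2) → w x = 0) →
        (∀ x : Fin 4 → ℝ, ‖x‖ ≤ η → w x = 0) →
        (∀ n : ℕ, n ≤ N → ∀ x : Fin 4 → ℝ, ‖iteratedFDeriv ℝ n w x‖ ≤ C * η ^ (-(n : ℤ))) →
        ‖∫ x : Fin 4 → ℝ, (w x : ℂ) * eC (θ * Gquad e x - ∑ i, v i * x i)‖ ≤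
          c * (η * ‖v‖) ^ (-(N : ℤ)) := by
  obtain ⟨c0, hc0, H⟩ := Iint_bound N 0
  refine ⟨c0 * C * 64, by positivity, ?_⟩
  intro η e v θ w hη he hv hθ hw hs _ hb
  obtain ⟨i, hi⟩ : ∃ i, ‖v‖ = |v i| := by
    obtain ⟨i, -, hi⟩ := Finset.exists_max_image (Finset.univ : Finset (Fin 4)) (fun i => |v i|)
      ⟨0, Finset.mem_univ _⟩
    refine ⟨i, le_antisymm ?_ ?_⟩
    · exact (pi_norm_le_iff_of_nonneg (abs_nonneg _)).2 (fun j => hi j (Finset.mem_univ _))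
    · exact norm_le_pi_norm v i
  have hvi : v i ≠ 0 := by
    intro h0
    rw [h0, abs_zero] at hi
    exact hv (norm_eq_zero.1 hi)
  rw [hi] at hθ ⊢
  have hea : |θ * (e i : ℝ)| = |θ| := by
    rcases he i with h | h <;> simp [h]
  set F : (Fin 4 → ℝ) → ℂ := fun x => (w x : ℂ) * eC (θ * Gquad e x - ∑ i, v i * x i) with hF
  have hFc : Continuous F := by
    apply (Complex.continuous_ofReal.comp hw.continuous).mul
    apply continuous_eC.comp
    unfold Gquad
    fun_prop
  have hFs : HasCompactSupport F := by
    apply HasCompactSupport.intro (isCompact_Icc (a := fun _ : Fin 4 => (-2 : ℝ)) (b := fun _ => 2))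
    intro x hx
    simp [hF, hs x hx]
  have hFi : Integrable F := hFc.integrable_of_hasCompactSupport hFs
  have mp := (volume_preserving_piFinSuccAbove (fun _ : Fin 4 => ℝ) i).symm
  have e1 : ∫ x, F x = ∫ z : ℝ × (Fin 3 → ℝ), F (i.insertNth z.1 z.2) := by
    rw [← mp.integral_comp (MeasurableEquiv.measurableEmbedding _)]
    rfl
  have hFi2 : Integrable (fun z : ℝ × (Fin 3 → ℝ) => F (i.insertNth z.1 z.2))
      (volume.prod volume) :=
    (mp.integrable_comp_emb (MeasurableEquiv.measurableEmbedding _)).2 hFi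
  have e2 : ∫ x, F x = ∫ y : Fin 3 → ℝ, ∫ t : ℝ, F (i.insertNth t y) := by
    rw [e1]
    exact integral_prod_symm _ hFi2
  have e3 : ∀ y : Fin 3 → ℝ, y ∉ Set.Icc (fun _ : Fin 3 => (-2 : ℝ)) (fun _ => 2) →
      ∫ t : ℝ, F (i.insertNth t y) = 0 := by
    intro y hy
    have : ∀ t : ℝ, F (i.insertNth t y) = 0 := by
      intro t
      simp only [hF]
      rw [hs, Complex.ofReal_zero, zero_mul]
      intro hx
      apply hy
      refine ⟨fun k => ?_, fun k => ?_⟩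
      · simpa using hx.1 (i.succAbove k)
      · simpa using hx.2 (i.succAbove k)
    simp [this]
  have e4 : ∀ y : Fin 3 → ℝ, ‖∫ t : ℝ, F (i.insertNth t y)‖ ≤ c0 * C * ((η * |v i|)⁻¹) ^ N := by
    intro y
    set g : ℝ → ℝ := fun t => w (i.insertNth t y) with hg
    set b : ℝ := θ * (∑ k, (e (i.succAbove k) : ℝ) * y k ^ 2) - ∑ k, v (i.succAbove k) * y k
      with hbdef
    have hgs : ∀ t, 2 < |t| → g t = 0 := by
      intro t ht
      apply hs
      intro hx
      have h1 := hx.1 i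
      have h2 := hx.2 i
      simp only [Fin.insertNth_apply_same] at h1 h2
      exact absurd (abs_le.2 ⟨h1, h2⟩) (not_le.2 ht)
    have hgd : ContDiff ℝ (⊤ : ℕ∞) g := by
      have : g = fun t => w (ContinuousLinearMap.single ℝ (fun _ : Fin 4 => ℝ) i t +
          i.insertNth 0 y) := by
        ext t; simp only [hg]; rw [insertNth_eq_affine]
      rw [this]
      exact hw.comp ((ContinuousLinearMap.contDiff _).add contDiff_const)
    have hFt : ∀ t : ℝ, F (i.insertNth t y) = ((g t * ((2 * (θ * e i) * t - v i) ^ 0)⁻¹ : ℝ) : ℂ) *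
        eC ((θ * e i) * t ^ 2 - v i * t + b) := by
      intro t
      simp only [hF, hg, pow_zero, inv_one, mul_one, Gquad]
      congr 2
      rw [Fin.sum_univ_succAbove _ i, Fin.sum_univ_succAbove _ i]
      simp only [Fin.insertNth_apply_same, Fin.insertNth_apply_succAbove, hbdef]
      ring
    have e5 : ∫ t : ℝ, F (i.insertNth t y) = Iint (θ * e i) (v i) b 0 g := by
      unfold Iint
      simp only [hFt]
      symm
      apply intervalIntegral.integral_eq_integral_of_support_subset
      intro t ht
      by_contra hcon
      apply ht
      have : g t = 0 := by
        apply hgs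
        by_contra h2
        have := abs_le.1 (not_lt.1 h2)
        exact hcon ⟨by linarith [this.1], by linarith [this.2]⟩
      simp [this]
    rw [e5]
    have := H (θ * e i) (v i) b η C g hη.1 (by linarith [hη.2]) hvi (by rw [hea]; exact hθ)
      (by linarith) hgd hgs (by
        intro n hn t
        apply slice_deriv w hw i y n t
        intro x
        have := hb n hn x
        rwa [zpow_neg, zpow_natCast, ← inv_pow] at this)
    simpa using this
  rw [e2, ← setIntegral_eq_integral_of_forall_compl_eq_zero e3]
  have hvol : volume.real (Set.Icc (fun _ : Fin 3 => (-2 : ℝ)) (fun _ => 2)) = 64 := by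
    rw [Measure.real, Real.volume_Icc_pi]
    simp
    norm_num
  have hfin : volume (Set.Icc (fun _ : Fin 3 => (-2 : ℝ)) (fun _ => 2)) < ⊤ :=
    isCompact_Icc.measure_lt_top
  refine (norm_setIntegral_le_of_norm_le_const hfin (fun y _ => e4 y)).trans (le_of_eq ?_)
  rw [hvol, zpow_neg, zpow_natCast, ← inv_pow]
  ring
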